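/- Let n = 2m+1 be odd and let V be the number of bulbs on at the terminal time under the equal mixture (weight 1/4 each, over (a,b) ∈ {0,1}²) of lightbulb processes on n bulbs with switch pattern 𝐧(a,b) = (1,…,m−1, m+a, m+b, m+2,…,n) and all bulbs initially off, with V_j the terminal state of bulb j. Then P(V_j = 1) = 1/2 for every j = 1,…,n, E V = n/2, and Var(V) = (n/4)(1 − λ̄_{n,2,𝐧}) + (n²/4)·λ̄_{n,2,𝐧}, where 𝐧 = (1,…,n). -/

import Mathlib

open MeasureTheory ProbabilityTheory Finset

/-- `λ_{n,b,s} = ∑_{t=0}^{b} C(b,t) (−2)^t (s)_t/(n)_t`. -/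
noncomputable def lam (n b s : ℕ) : ℝ :=
  ∑ t ∈ Finset.range (b + 1),
    (b.choose t : ℝ) * (-2 : ℝ) ^ t * (s.descFactorial t : ℝ) / (n.descFactorial t : ℝ)

/-- `λ̄_{n,b,𝐧}` for the full pattern `𝐧 = (1,…,n)` with `n = 2m+1` odd: the two factors
`λ_{n,b,m}` and `λ_{n,b,m+1}` in the product are both replaced by their average. -/
noncomputable def lamBarFull (n b m : ℕ) : ℝ :=
  (∏ r ∈ Finset.Icc 1 n \ {m, m + 1}, lam n b r) * ((lam n b m + lam n b (m + 1)) / 2) ^ 2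

/-- The arrays of switch variables having exactly `s r` switches in stage `r`. -/
def validArrays (n k : ℕ) (s : Fin k → ℕ) : Finset (Fin k → Fin n → Bool) :=
  Finset.univ.filter (fun e => ∀ r, (Finset.univ.filter (fun j => e r j = true)).card = s r)

/-- Terminal state of bulb `j` (all bulbs initially off). -/
def bulbOn {n k : ℕ} (e : Fin k → Fin n → Bool) (j : Fin n) : Bool :=
  decide ((Finset.univ.filter (fun r => e r j = true)).card % 2 = 1)

/-- Number of bulbs on at the terminal time. -/
def numOn {n k : ℕ} (e : Fin k → Fin n → Bool) : ℕ :=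
  (Finset.univ.filter (fun j => bulbOn e j = true)).card

/-- The switch pattern `𝐧(a,b) = (1,…,m−1, m+a, m+b, m+2,…,n)` for `n = 2m+1` odd:
stage `r` (1-based value `(r:ℕ)+1`) toggles the indicated number of bulbs. -/
def oddPattern (n m a b : ℕ) : Fin n → ℕ := fun r =>
  if (r : ℕ) + 1 = m then m + a
  else if (r : ℕ) + 1 = m + 1 then m + b
  else (r : ℕ) + 1

/-- The spin of a bulb: `-1` if it is switched, `1` otherwise. -/
def spin (x : Bool) : ℝ := if x = true then -1 else 1

/-- The sets of exactly `s` switched bulbs among `n`, as indicator functions. -/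
def switchSets (n s : ℕ) : Finset (Fin n → Bool) :=
  Finset.univ.filter fun x => (Finset.univ.filter fun j => x j = true).card = s

lemma spin_mul_self (x : Bool) : spin x * spin x = 1 := by
  cases x <;> simp [spin]

lemma switchSets_nonempty {n s : ℕ} (h : s ≤ n) : (switchSets n s).Nonempty := by
  obtain ⟨t, -, ht⟩ := Finset.exists_subset_card_eq
    (s := (Finset.univ : Finset (Fin n))) (n := s) (by simpa using h)
  exact ⟨fun j => decide (j ∈ t), by simp [switchSets, ht]⟩

lemma sum_switchSets_comp_perm {n s : ℕ} (π : Equiv.Perm (Fin n)) (f : (Fin n → Bool) → ℝ) :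
    ∑ x ∈ switchSets n s, f (x ∘ π) = ∑ x ∈ switchSets n s, f x := by
  refine Finset.sum_equiv (Equiv.arrowCongr π.symm (Equiv.refl Bool)) (fun x => ?_) (fun x _ => rfl)
  have : (Finset.univ.filter fun j => x (π j) = true).card
      = (Finset.univ.filter fun j => x j = true).card :=
    Finset.card_equiv π (by simp)
  simp [switchSets, Equiv.arrowCongr, this]

lemma sum_spin {n : ℕ} (x : Fin n → Bool) :
    ∑ j, spin (x j) = n - 2 * ((Finset.univ.filter fun j => x j = true).card : ℝ) := by
  have h : ∀ j, spin (x j) = 1 - 2 * (if x j = true then (1 : ℝ) else 0) := by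
    intro j
    unfold spin
    split_ifs <;> norm_num
  simp_rw [h, Finset.sum_sub_distrib, ← Finset.mul_sum, Finset.sum_boole]
  simp

lemma sum_spin_of_mem {n s : ℕ} {x : Fin n → Bool} (hx : x ∈ switchSets n s) :
    ∑ j, spin (x j) = n - 2 * (s : ℝ) := by
  rw [sum_spin, (Finset.mem_filter.1 hx).2]

lemma lam_one (n s : ℕ) : lam n 1 s = 1 - 2 * s / n := by
  simp [lam, Finset.sum_range_succ]
  ring

lemma lam_two {n : ℕ} (hn : 2 ≤ n) (s : ℕ) :
    (n * (n - 1) : ℝ) * lam n 2 s = (n - 2 * s) ^ 2 - n := by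
  have h2 : ∀ k : ℕ, (k.descFactorial 2 : ℝ) = k * (k - 1) := by
    intro k
    rcases k with _ | k
    · simp
    · simp [Nat.descFactorial_succ]
      ring
  have hn' : (2 : ℝ) ≤ n := by exact_mod_cast hn
  have h0 : (n : ℝ) ≠ 0 := by linarith
  have h1 : (n : ℝ) - 1 ≠ 0 := by linarith
  simp only [lam, Finset.sum_range_succ, Finset.sum_range_zero, h2, Nat.descFactorial_one,
    Nat.descFactorial_zero, Nat.choose_self, Nat.choose_zero_right, Nat.choose_one_right]
  field_simp
  push_cast
  ring

lemma sum_switchSets_spin {n : ℕ} (s : ℕ) (j : Fin n) :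
    ∑ x ∈ switchSets n s, spin (x j) = (switchSets n s).card * lam n 1 s := by
  have hn : (n : ℝ) ≠ 0 := by
    have := j.pos
    positivity
  have hsym : ∀ i, ∑ x ∈ switchSets n s, spin (x i) = ∑ x ∈ switchSets n s, spin (x j) := by
    intro i
    simpa using sum_switchSets_comp_perm (s := s) (Equiv.swap i j) fun x => spin (x j)
  have htot : ∑ i : Fin n, ∑ x ∈ switchSets n s, spin (x i)
      = (switchSets n s).card * (n - 2 * s : ℝ) := by
    rw [Finset.sum_comm, Finset.sum_congr rfl fun x hx => sum_spin_of_mem hx, Finset.sum_const,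
      nsmul_eq_mul]
  simp only [hsym, Finset.sum_const, Finset.card_univ, Fintype.card_fin, nsmul_eq_mul] at htot
  rw [lam_one]
  field_simp
  linarith

lemma exists_perm_map_pair {α : Type*} [DecidableEq α] {i i' j j' : α} (h : i ≠ i')
    (h' : j ≠ j') : ∃ π : Equiv.Perm α, π i = j ∧ π i' = j' := by
  refine ⟨Equiv.swap (Equiv.swap i j i') j' * Equiv.swap i j, ?_, ?_⟩
  · have : j ≠ Equiv.swap i j i' := fun e => h ((Equiv.swap i j).injective (by simpa using e))
    simp [Equiv.swap_apply_of_ne_of_ne this h']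
  · simp

lemma sum_switchSets_spin_mul_spin {n : ℕ} (s : ℕ) {j j' : Fin n} (hj : j ≠ j') :
    ∑ x ∈ switchSets n s, spin (x j) * spin (x j') = (switchSets n s).card * lam n 2 s := by
  have hn : 2 ≤ n := by
    by_contra h
    exact hj (Fin.ext (by omega))
  have hn' : (2 : ℝ) ≤ n := by exact_mod_cast hn
  have hnn : (n * (n - 1) : ℝ) ≠ 0 := mul_ne_zero (by linarith) (by linarith)
  set S := ∑ x ∈ switchSets n s, spin (x j) * spin (x j')
  have hsym : ∀ i i', i ≠ i' → ∑ x ∈ switchSets n s, spin (x i) * spin (x i') = S := by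
    intro i i' hi
    obtain ⟨π, rfl, rfl⟩ := exists_perm_map_pair hj hi
    exact (sum_switchSets_comp_perm (s := s) π fun x => spin (x j) * spin (x j'))
  have hentry : ∀ i i' : Fin n, ∑ x ∈ switchSets n s, spin (x i) * spin (x i')
      = S + if i = i' then (switchSets n s).card - S else 0 := by
    intro i i'
    split_ifs with hi
    · subst hi
      simp [spin_mul_self]
    · simp [hsym i i' hi]
  have htot : ∑ i : Fin n, ∑ i' : Fin n, ∑ x ∈ switchSets n s, spin (x i) * spin (x i')
      = (switchSets n s).card * (n - 2 * s : ℝ) ^ 2 := by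
    have : ∀ i : Fin n, ∑ i' : Fin n, ∑ x ∈ switchSets n s, spin (x i) * spin (x i')
        = ∑ x ∈ switchSets n s, ∑ i' : Fin n, spin (x i) * spin (x i') :=
      fun i => Finset.sum_comm
    simp_rw [this]
    rw [Finset.sum_comm]
    simp_rw [← Finset.sum_mul_sum]
    rw [Finset.sum_congr rfl fun x hx => by rw [sum_spin_of_mem hx]]
    simp [sq]
  simp only [hentry, Finset.sum_add_distrib, Finset.sum_ite_eq, Finset.mem_univ, if_true,
    Finset.sum_const, Finset.card_univ, Fintype.card_fin, nsmul_eq_mul] at htot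
  apply mul_left_cancel₀ hnn
  linear_combination htot - ((switchSets n s).card : ℝ) * lam_two hn s

lemma validArrays_eq_piFinset (n k : ℕ) (s : Fin k → ℕ) :
    validArrays n k s = Fintype.piFinset fun r => switchSets n (s r) := by
  ext e
  simp [validArrays, switchSets]

lemma spin_bulbOn {n k : ℕ} (e : Fin k → Fin n → Bool) (j : Fin n) :
    spin (bulbOn e j) = ∏ r, spin (e r j) := by
  simp only [spin, bulbOn, Finset.prod_ite, Finset.prod_const, one_pow, mul_one, decide_eq_true_eq]
  split_ifs with h
  · rw [Odd.neg_one_pow (Nat.odd_iff.2 h)]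
  · rw [Even.neg_one_pow (Nat.even_iff.2 (by omega))]

lemma numOn_sub_half {n k : ℕ} (e : Fin k → Fin n → Bool) :
    (numOn e : ℝ) - n / 2 = -(1 / 2) * ∑ j, spin (bulbOn e j) := by
  rw [sum_spin, numOn]
  ring

/-- Stages are independent, so a product over stages averages to the product of the averages. -/
lemma average_prod_validArrays {n k : ℕ} {s : Fin k → ℕ} (hs : ∀ r, s r ≤ n)
    (g : (Fin n → Bool) → ℝ) (c : ℕ → ℝ)
    (hg : ∀ t, ∑ x ∈ switchSets n t, g x = (switchSets n t).card * c t) :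
    ((validArrays n k s).card : ℝ)⁻¹ * ∑ e ∈ validArrays n k s, ∏ r, g (e r)
      = ∏ r, c (s r) := by
  rw [validArrays_eq_piFinset, ← Finset.prod_univ_sum, Fintype.card_piFinset]
  simp_rw [hg, Finset.prod_mul_distrib]
  push_cast
  rw [inv_mul_cancel_left₀]
  refine Finset.prod_ne_zero_iff.2 fun r _ => ?_
  exact_mod_cast (Finset.card_pos.2 (switchSets_nonempty (hs r))).ne'

lemma oddPattern_le {n m a b : ℕ} (hm : n = 2 * m + 1) (ha : a ≤ 1) (hb : b ≤ 1) (r : Fin n) :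
    oddPattern n m a b r ≤ n := by
  have := r.isLt
  unfold oddPattern
  split_ifs <;> omega

lemma prod_oddPattern {n m : ℕ} (hm : n = 2 * m + 1) (hm0 : m ≠ 0) (a b : ℕ) (c : ℕ → ℝ) :
    ∏ r, c (oddPattern n m a b r)
      = (∏ r ∈ Finset.Icc 1 n \ {m, m + 1}, c r) * (c (m + a) * c (m + b)) := by
  let G : ℕ → ℝ := fun r => c (if r = m then m + a else if r = m + 1 then m + b else r)
  have h1 : ∏ r, c (oddPattern n m a b r) = ∏ r ∈ Finset.Icc 1 n, G r := by
    have h2 : ∏ r ∈ Finset.Icc 1 n, G r = ∏ r ∈ Finset.range n, G (r + 1) := by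
      rw [Finset.range_eq_Ico, Finset.prod_Ico_add' G 0 n 1]
      rfl
    rw [h2, ← Fin.prod_univ_eq_prod_range fun r => G (r + 1)]
    refine Finset.prod_congr rfl fun r _ => ?_
    simp only [oddPattern, G, Nat.add_right_cancel_iff]
  have hsub : ({m, m + 1} : Finset ℕ) ⊆ Finset.Icc 1 n := by
    intro r hr
    simp only [Finset.mem_insert, Finset.mem_singleton] at hr
    rw [Finset.mem_Icc]
    omega
  rw [h1, ← Finset.prod_sdiff hsub]
  congr 1
  · refine Finset.prod_congr rfl fun r hr => ?_
    simp only [Finset.mem_sdiff, Finset.mem_insert, Finset.mem_singleton, not_or] at hr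
    simp [G, hr.2.1, hr.2.2]
  · rw [Finset.prod_pair (by omega)]
    simp [G]

lemma integral_oddMixture {n m : ℕ} (hm : n = 2 * m + 1)
    {Ω : Type} [MeasurableSpace Ω] (P : Measure Ω) [IsProbabilityMeasure P]
    (A : Ω → (Fin n → Fin n → Bool)) (hA : Measurable A)
    (hdist : ∀ e, P {ω | A ω = e} =
      (1 / 4 : ENNReal) * ∑ a ∈ Finset.range 2, ∑ b ∈ Finset.range 2,
        (if e ∈ validArrays n n (oddPattern n m a b)
         then ((validArrays n n (oddPattern n m a b)).card : ENNReal)⁻¹ else 0))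
    (g : (Fin n → Bool) → ℝ) (c : ℕ → ℝ)
    (hg : ∀ t, ∑ x ∈ switchSets n t, g x = (switchSets n t).card * c t) :
    ∫ ω, ∏ r, g (A ω r) ∂P
      = 1 / 4 * ∑ a ∈ Finset.range 2, ∑ b ∈ Finset.range 2, ∏ r, c (oddPattern n m a b r) := by
  have hreal : ∀ e, (P.map A).real {e} =
      1 / 4 * ∑ a ∈ Finset.range 2, ∑ b ∈ Finset.range 2,
        (if e ∈ validArrays n n (oddPattern n m a b)
         then ((validArrays n n (oddPattern n m a b)).card : ℝ)⁻¹ else 0) := by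
    intro e
    have hfin : ∀ a b : ℕ, (if e ∈ validArrays n n (oddPattern n m a b)
         then ((validArrays n n (oddPattern n m a b)).card : ENNReal)⁻¹ else 0) ≠ ⊤ := by
      intro a b
      split_ifs with he
      · simpa using Finset.ne_empty_of_mem he
      · simp
    rw [map_measureReal_apply hA (measurableSet_singleton e), Measure.real]
    change (P {ω | A ω = e}).toReal = _
    rw [hdist, ENNReal.toReal_mul,
      ENNReal.toReal_sum fun a _ => ENNReal.sum_ne_top.2 fun b _ => hfin a b]
    simp_rw [ENNReal.toReal_sum fun b _ => hfin _ b]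
    congr 1
    · simp
    · refine Finset.sum_congr rfl fun a _ => Finset.sum_congr rfl fun b _ => ?_
      split_ifs <;> simp
  have hmap := integral_map (μ := P) hA.aemeasurable
    (f := fun e : Fin n → Fin n → Bool => ∏ r, g (e r))
    (Measurable.of_discrete.aestronglyMeasurable)
  have : IsProbabilityMeasure (P.map A) := Measure.isProbabilityMeasure_map hA.aemeasurable
  rw [← hmap, integral_fintype .of_finite]
  simp_rw [hreal, smul_eq_mul, mul_assoc, ← Finset.mul_sum, Finset.sum_mul]
  congr 1
  rw [Finset.sum_comm]
  refine Finset.sum_congr rfl fun a ha => ?_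
  rw [Finset.sum_comm]
  refine Finset.sum_congr rfl fun b hb => ?_
  rw [Finset.mem_range] at ha hb
  rw [← average_prod_validArrays (oddPattern_le hm (by omega) (by omega)) g c hg, Finset.mul_sum]
  simp [ite_mul, Finset.sum_ite_mem]

/-- For the symmetrized odd lightbulb variable `V`: each bulb is on with probability `1/2`,
`E V = n/2`, and `Var(V) = (n/4)(1 − λ̄_{n,2,𝐧}) + (n²/4) λ̄_{n,2,𝐧}`. -/
theorem lightbulb_V_mean_variance {n m : ℕ} (hm : n = 2 * m + 1)
    {Ω : Type} [MeasurableSpace Ω] (P : Measure Ω) [IsProbabilityMeasure P]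
    (A : Ω → (Fin n → Fin n → Bool)) (hA : Measurable A)
    (hdist : ∀ e, P {ω | A ω = e} =
      (1 / 4 : ENNReal) * ∑ a ∈ Finset.range 2, ∑ b ∈ Finset.range 2,
        (if e ∈ validArrays n n (oddPattern n m a b)
         then ((validArrays n n (oddPattern n m a b)).card : ENNReal)⁻¹ else 0)) :
    (∀ j : Fin n, P {ω | bulbOn (A ω) j = true} = 1 / 2) ∧
    (∫ ω, (numOn (A ω) : ℝ) ∂P = (n : ℝ) / 2) ∧
    (variance (fun ω => (numOn (A ω) : ℝ)) P
      = ((n : ℝ) / 4) * (1 - lamBarFull n 2 m) + ((n : ℝ) ^ 2 / 4) * lamBarFull n 2 m) := by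
  have hint : ∀ f : (Fin n → Fin n → Bool) → ℝ, Integrable (fun ω => f (A ω)) P := by
    intro f
    have : IsProbabilityMeasure (P.map A) := Measure.isProbabilityMeasure_map hA.aemeasurable
    exact (Integrable.of_finite (μ := P.map A) (f := f)).comp_measurable hA
  have hone : ∀ j, ∫ ω, spin (bulbOn (A ω) j) ∂P = 0 := by
    intro j
    simp_rw [spin_bulbOn]
    rw [integral_oddMixture hm P A hA hdist (fun x => spin (x j)) (lam n 1)
      fun t => sum_switchSets_spin t j]
    have hcancel : lam n 1 (m + 1) = -lam n 1 m := by
      rw [lam_one, lam_one, hm]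
      push_cast
      field_simp
      ring
    rcases eq_or_ne m 0 with rfl | hm0
    · subst hm
      simp [Finset.sum_range_succ, oddPattern] at hcancel ⊢
      linarith
    · simp only [prod_oddPattern hm hm0, Finset.sum_range_succ, Finset.sum_range_zero, add_zero,
        hcancel]
      ring
  have htwo : ∀ i j, i ≠ j →
      ∫ ω, spin (bulbOn (A ω) i) * spin (bulbOn (A ω) j) ∂P = lamBarFull n 2 m := by
    intro i j hij
    have hm0 : m ≠ 0 := by
      rintro rfl
      exact hij (Fin.ext (by omega))
    simp_rw [spin_bulbOn, ← Finset.prod_mul_distrib]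
    rw [integral_oddMixture hm P A hA hdist (fun x => spin (x i) * spin (x j)) (lam n 2)
      fun t => sum_switchSets_spin_mul_spin t hij]
    simp only [prod_oddPattern hm hm0, Finset.sum_range_succ, Finset.sum_range_zero, add_zero,
      lamBarFull]
    ring
  have hmean : ∫ ω, (numOn (A ω) : ℝ) ∂P = (n : ℝ) / 2 := by
    have h : ∀ ω, (numOn (A ω) : ℝ) = -(1 / 2) * ∑ j, spin (bulbOn (A ω) j) + n / 2 :=
      fun ω => by linarith [numOn_sub_half (A ω)]
    simp_rw [h]
    rw [integral_add (hint fun e => -(1 / 2) * ∑ j, spin (bulbOn e j)) (integrable_const _),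
      integral_const_mul, integral_finsetSum _ fun j _ => hint fun e => spin (bulbOn e j)]
    simp [hone]
  refine ⟨fun j => ?_, hmean, ?_⟩
  · have hset : MeasurableSet {ω | bulbOn (A ω) j = true} :=
      hA (MeasurableSet.of_discrete (s := {e | bulbOn e j = true}))
    have hspin : ∀ ω, spin (bulbOn (A ω) j)
        = 1 - 2 * {ω | bulbOn (A ω) j = true}.indicator (fun _ => (1 : ℝ)) ω := by
      intro ω
      by_cases h : bulbOn (A ω) j = true
      · simp [spin, h]
        norm_num
      · simp [spin, h]
    have h := hone j
    simp_rw [hspin] at h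
    rw [integral_sub (integrable_const _)
      (((integrable_const (1 : ℝ)).indicator hset).const_mul 2), integral_const_mul,
      integral_indicator_const _ hset] at h
    simp at h
    have hr : P.real {ω | bulbOn (A ω) j = true} = 1 / 2 := by linarith
    rw [← ENNReal.toReal_eq_toReal_iff' (measure_ne_top _ _) (by simp)]
    simpa [Measure.real] using hr
  · rw [variance_eq_integral (hint fun e => (numOn e : ℝ)).aemeasurable, hmean]
    have hsq : ∀ ω, ((numOn (A ω) : ℝ) - n / 2) ^ 2
        = 1 / 4 * ∑ i, ∑ j, spin (bulbOn (A ω) i) * spin (bulbOn (A ω) j) := by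
      intro ω
      rw [numOn_sub_half, ← Finset.sum_mul_sum]
      ring
    have hentry : ∀ i j, ∫ ω, spin (bulbOn (A ω) i) * spin (bulbOn (A ω) j) ∂P
        = lamBarFull n 2 m + if i = j then 1 - lamBarFull n 2 m else 0 := by
      intro i j
      split_ifs with h
      · subst h
        simp [spin_mul_self]
      · simp [htwo i j h]
    simp_rw [hsq]
    rw [integral_const_mul, integral_finsetSum _ fun i _ =>
      hint fun e => ∑ j, spin (bulbOn e i) * spin (bulbOn e j)]
    have hrow : ∀ i, ∫ ω, ∑ j, spin (bulbOn (A ω) i) * spin (bulbOn (A ω) j) ∂P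
        = ∑ j, (lamBarFull n 2 m + if i = j then 1 - lamBarFull n 2 m else 0) := by
      intro i
      rw [integral_finsetSum _ fun j _ => hint fun e => spin (bulbOn e i) * spin (bulbOn e j)]
      exact Finset.sum_congr rfl fun j _ => hentry i j
    simp_rw [hrow]
    simp only [Finset.sum_add_distrib, Finset.sum_ite_eq, Finset.mem_univ, if_true,
      Finset.sum_const, Finset.card_univ, Fintype.card_fin, nsmul_eq_mul]
    ring
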